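/- Let T be a colored tree that is closed under initial segments, and let w and u be branches of T such that the blue content of w is an initial segment of the blue content of u and the yellow content of w is an initial segment of the yellow content of u. Then w is an initial segment of u. -/

import Mathlib

/-- The two colors of colored bits. -/
inductive CColor : Type where
  | blue : CColor
  | yellow : CColor
deriving DecidableEq

/-- A colored bit: a content in {0,1} (as `Bool`) together with a color. -/
abbrev CBit := Bool × CColor

/-- The content of a colored bit string: the sequence of contents of its bits. -/
def content (v : List CBit) : List Bool := v.map Prod.fst

/-- The blue content: the sequence of the contents of the blue bits. -/
def blueContent (v : List CBit) : List Bool :=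
  (v.filter (fun b => match b.2 with | CColor.blue => true | CColor.yellow => false)).map
    Prod.fst

/-- The yellow content: the sequence of the contents of the yellow bits. -/
def yellowContent (v : List CBit) : List Bool :=
  (v.filter (fun b => match b.2 with | CColor.blue => false | CColor.yellow => true)).map
    Prod.fst

/-- Two one-bit extensions of the same branch carry the same color. -/
theorem color_eq_of_append_singleton_mem {T : Set (List CBit)}
    (hb : ∀ v ∈ T, ∀ w ∈ T, content v = content w → v = w)
    (hc : ∀ v ∈ T,
      ¬((v ++ [(false, CColor.blue)]) ∈ T ∧ (v ++ [(true, CColor.yellow)]) ∈ T) ∧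
      ¬((v ++ [(false, CColor.yellow)]) ∈ T ∧ (v ++ [(true, CColor.blue)]) ∈ T))
    {p : List CBit} {a b : CBit} (hp : p ∈ T) (ha : p ++ [a] ∈ T) (hb' : p ++ [b] ∈ T) :
    a.2 = b.2 := by
  by_cases h : a.1 = b.1
  · have hab := hb _ ha _ hb' (by simp [content, h])
    simp_all
  · obtain ⟨h₁, h₂⟩ := hc p hp
    rcases a with ⟨_ | _, _ | _⟩ <;> rcases b with ⟨_ | _, _ | _⟩ <;> simp_all

/-- The prefix criterion for two branches with a common initial part `p`. -/
theorem prefix_of_append_mem {T : Set (List CBit)}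
    (hb : ∀ v ∈ T, ∀ w ∈ T, content v = content w → v = w)
    (hc : ∀ v ∈ T,
      ¬((v ++ [(false, CColor.blue)]) ∈ T ∧ (v ++ [(true, CColor.yellow)]) ∈ T) ∧
      ¬((v ++ [(false, CColor.yellow)]) ∈ T ∧ (v ++ [(true, CColor.blue)]) ∈ T))
    (hclosed : ∀ v ∈ T, ∀ u : List CBit, u <+: v → u ∈ T)
    (p w u : List CBit) (hw : p ++ w ∈ T) (hu : p ++ u ∈ T)
    (hblue : blueContent w <+: blueContent u)
    (hyellow : yellowContent w <+: yellowContent u) :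
    w <+: u := by
  induction w generalizing p u with
  | nil => exact List.nil_prefix
  | cons a w ih =>
    cases u with
    | nil => rcases a with ⟨_, _ | _⟩ <;> simp [blueContent, yellowContent] at hblue hyellow
    | cons b u =>
      have hcol := color_eq_of_append_singleton_mem hb hc
        (hclosed _ hw p (List.prefix_append _ _))
        (hclosed _ hw (p ++ [a]) ⟨w, by simp⟩) (hclosed _ hu (p ++ [b]) ⟨u, by simp⟩)
      obtain ⟨x, c⟩ := a
      obtain ⟨y, d⟩ := b
      obtain rfl : c = d := hcol
      have key : x = y ∧ blueContent w <+: blueContent u ∧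
          yellowContent w <+: yellowContent u := by
        cases c <;> simp_all [blueContent, yellowContent, List.cons_prefix_cons]
      obtain ⟨rfl, hblue', hyellow'⟩ := key
      exact List.cons_prefix_cons.2
        ⟨rfl, ih (p ++ [(x, c)]) u (by simpa using hw) (by simpa using hu) hblue' hyellow'⟩

/-- Lemma 10.3: if T is a colored tree (conditions (a)–(c)), additionally closed
under initial segments, and w, u are branches of T with blue(w) ⊑ blue(u) and
yellow(w) ⊑ yellow(u), then w ⊑ u. -/
theorem coloredTree_prefix (T : Set (List CBit))
    -- (a) the set of contents of elements of T is nonempty, ...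
    (ha_ne : {s : List Bool | ∃ v ∈ T, content v = s}.Nonempty)
    -- ... closed under initial segments, ...
    (ha_pref : ∀ s ∈ {s : List Bool | ∃ v ∈ T, content v = s}, ∀ t : List Bool,
      t <+: s → t ∈ {s : List Bool | ∃ v ∈ T, content v = s})
    -- ... and contains w0 iff it contains w1:
    (ha_sib : ∀ w : List Bool,
      (w ++ [false]) ∈ {s : List Bool | ∃ v ∈ T, content v = s} ↔
        (w ++ [true]) ∈ {s : List Bool | ∃ v ∈ T, content v = s})
    -- (b) any two elements of T with the same content are equal:
    (hb : ∀ v ∈ T, ∀ w ∈ T, content v = content w → v = w)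
    -- (c) for no v ∈ T are both v·(blue 0) and v·(yellow 1) in T,
    --     nor both v·(yellow 0) and v·(blue 1) in T:
    (hc : ∀ v ∈ T,
      ¬((v ++ [(false, CColor.blue)]) ∈ T ∧ (v ++ [(true, CColor.yellow)]) ∈ T) ∧
      ¬((v ++ [(false, CColor.yellow)]) ∈ T ∧ (v ++ [(true, CColor.blue)]) ∈ T))
    -- T is additionally assumed closed under initial segments:
    (hclosed : ∀ v ∈ T, ∀ u : List CBit, u <+: v → u ∈ T)
    (w u : List CBit) (hw : w ∈ T) (hu : u ∈ T)
    (hblue : blueContent w <+: blueContent u)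
    (hyellow : yellowContent w <+: yellowContent u) :
    w <+: u := by
  exact prefix_of_append_mem hb hc hclosed [] w u hw hu hblue hyellow
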